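/- Let Ω be a class of unital C*-algebras each of which is weakly (m, n)-divisible with m ≠ n. Let A ∈ WTAΩ be a simple unital stably finite C*-algebra such that M_k(A) ∈ WTAΩ for every integer k. Then A is secondly weakly (m, n)-divisible. -/

import Mathlib

open Filter Matrix

attribute [local instance] Matrix.normedAddCommGroup

/-- Positivity via the star structure: in a C*-algebra, `x ≥ 0` iff `x = y* y`. -/
def StarPos {R : Type*} [Mul R] [Star R] (x : R) : Prop := ∃ y : R, x = star y * y

/-- Cuntz subequivalence in a normed star ring. -/
def CuntzG {R : Type*} [Ring R] [StarRing R] [NormedAddCommGroup R] (a b : R) : Prop :=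
  ∃ v : ℕ → R, Tendsto (fun t => ‖v t * b * star (v t) - a‖) atTop (nhds 0)

/-- Cuntz subequivalence between square matrices over `R` of possibly different sizes,
witnessed by (rectangular) matrices with entries in the subset `S`. -/
def MatCuntzLE {R : Type*} [Ring R] [StarRing R] [NormedAddCommGroup R] (S : Set R)
    {I J : Type} [Fintype I] [Fintype J] (x : Matrix I I R) (y : Matrix J J R) : Prop :=
  ∃ v : ℕ → Matrix I J R, (∀ t i j, v t i j ∈ S) ∧
    Tendsto (fun t => ‖v t * y * (v t)ᴴ - x‖) atTop (nhds 0)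

/-- `b` is the cutoff `(a - ε)₊`, characterized by approximation by polynomials vanishing
at `0` which converge uniformly to `t ↦ max 0 (t - ε)` on `[0, M] ⊇ spectrum a`. -/
def IsCutoff {R : Type*} [Ring R] [Algebra ℝ R] [NormedAddCommGroup R]
    (ε M : ℝ) (a b : R) : Prop :=
  spectrum ℝ a ⊆ Set.Icc 0 M ∧
  ∃ q : ℕ → Polynomial ℝ, (∀ j, (q j).eval 0 = 0) ∧
    (∀ δ : ℝ, 0 < δ → ∃ J : ℕ, ∀ j ≥ J, ∀ t ∈ Set.Icc (0 : ℝ) M,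
      |(q j).eval t - max 0 (t - ε)| < δ) ∧
    Tendsto (fun j => ‖Polynomial.aeval a (q j) - b‖) atTop (nhds 0)

/-- Weak `(m, n)`-divisibility (Definition 2.2) of the C*-algebra sitting on the subset
`S ⊆ R`, with `M_∞` realized by square matrices over `R` of arbitrary size and Cuntz
comparison witnessed inside `S`. -/
def WeaklyDivOn {R : Type*} [Ring R] [StarRing R] [Algebra ℝ R] [NormedAddCommGroup R]
    (S : Set R) (m n : ℕ) : Prop :=
  ∀ (k : ℕ) (a : Matrix (Fin k) (Fin k) R), (∀ i j, a i j ∈ S) →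
    (∃ N : Matrix (Fin k) (Fin k) R, (∀ i j, N i j ∈ S) ∧ a = star N * N) →
    ∀ ε : ℝ, 0 < ε →
    ∃ (K : ℕ) (x : Fin n → Matrix (Fin K) (Fin K) R),
      (∀ j i l, x j i l ∈ S) ∧
      (∀ j, ∃ N : Matrix (Fin K) (Fin K) R, (∀ i l, N i l ∈ S) ∧ x j = star N * N) ∧
      (∀ j, MatCuntzLE S (Matrix.blockDiagonal fun _ : Fin m => x j) a) ∧
      (∀ (M : ℝ) (b : Matrix (Fin k) (Fin k) R), IsCutoff ε M a b →
        MatCuntzLE S b (Matrix.blockDiagonal x))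

/-- Secondly weak `(m, n)`-divisibility (Definition 2.3): as above, but with
`m⟨xⱼ⟩ ≤ ⟨a⟩ + ⟨a⟩`. -/
def SecondlyWeaklyDivOn {R : Type*} [Ring R] [StarRing R] [Algebra ℝ R]
    [NormedAddCommGroup R] (S : Set R) (m n : ℕ) : Prop :=
  ∀ (k : ℕ) (a : Matrix (Fin k) (Fin k) R), (∀ i j, a i j ∈ S) →
    (∃ N : Matrix (Fin k) (Fin k) R, (∀ i j, N i j ∈ S) ∧ a = star N * N) →
    ∀ ε : ℝ, 0 < ε →
    ∃ (K : ℕ) (x : Fin n → Matrix (Fin K) (Fin K) R),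
      (∀ j i l, x j i l ∈ S) ∧
      (∀ j, ∃ N : Matrix (Fin K) (Fin K) R, (∀ i l, N i l ∈ S) ∧ x j = star N * N) ∧
      (∀ j, MatCuntzLE S (Matrix.blockDiagonal fun _ : Fin m => x j)
        (Matrix.blockDiagonal fun _ : Fin 2 => a)) ∧
      (∀ (M : ℝ) (b : Matrix (Fin k) (Fin k) R), IsCutoff ε M a b →
        MatCuntzLE S b (Matrix.blockDiagonal x))

/-- Membership in the class `WTAΩ` (Definition 2.6), phrased in any unital normed star
algebra `R` (so that it applies both to `A` and to the matrix algebras `M_k(A)`). -/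
def WTAMemG {R : Type*} [Ring R] [StarRing R] [Module ℂ R] [NormedAddCommGroup R]
    (Ω : Set (NonUnitalStarSubalgebra ℂ R × R)) : Prop :=
  ∀ (F : Finset R) (ε : ℝ), 0 < ε → ∀ a : R, StarPos a → a ≠ 0 →
    ∃ (p g : R) (B : NonUnitalStarSubalgebra ℂ R),
      (B, p) ∈ Ω ∧ IsClosed (B : Set R) ∧
      IsSelfAdjoint p ∧ IsIdempotentElem p ∧
      StarPos g ∧ StarPos (1 - g) ∧ g ∈ B ∧ p ∈ B ∧
      (∀ b ∈ B, p * b = b ∧ b * p = b) ∧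
      (∀ x ∈ F, (∃ b ∈ B, ‖(p - g) * x - b‖ < ε) ∧ (∃ b ∈ B, ‖x * (p - g) - b‖ < ε)) ∧
      (∀ x ∈ F, ‖(p - g) * x - x * (p - g)‖ < ε) ∧
      CuntzG (1 - (p - g)) a ∧
      ‖a‖ - ε ≤ ‖(p - g) * a * (p - g)‖

/-- Stable finiteness. -/
def StablyFinite (A : Type*) [CStarAlgebra A] : Prop :=
  ∀ (k : ℕ) (v : Matrix (Fin k) (Fin k) A),
    IsIdempotentElem (star v * v) →
    (star v * v) * (v * star v) = v * star v →
    star v * v = v * star v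

/-- Simplicity. -/
def IsSimpleCStar (A : Type*) [CStarAlgebra A] : Prop :=
  ∀ I : TwoSidedIdeal A, IsClosed (I : Set A) →
    (I : Set A) = {0} ∨ (I : Set A) = Set.univ

section CStar

theorem mem_closure_conj_trans {D : Type*} [CStarAlgebra D] {x y z : D}
    (hxy : x ∈ closure (Set.range fun v : D => v * y * star v))
    (hyz : y ∈ closure (Set.range fun v : D => v * z * star v)) :
    x ∈ closure (Set.range fun v : D => v * z * star v) := by
  refine closure_minimal ?_ isClosed_closure hxy
  rintro _ ⟨w, rfl⟩
  refine map_mem_closure (f := fun y => w * y * star w) (by fun_prop) hyz ?_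
  rintro _ ⟨v, rfl⟩
  exact ⟨w * v, by simp [mul_assoc]⟩

variable {D : Type*} [CStarAlgebra D] [PartialOrder D] [StarOrderedRing D]

theorem exists_selfAdjoint_conj_add_eq_one {y : D} (hy : 0 ≤ y) {η : ℝ} (hη : 0 < η) :
    ∃ u : D, IsSelfAdjoint u ∧ u * (y + algebraMap ℝ D η) * u = 1 := by
  have hpos : ∀ t : ℝ, 0 < max t 0 + η := fun t => by positivity
  have hc : Continuous fun t : ℝ => (√(max t 0 + η))⁻¹ :=
    (by fun_prop : Continuous fun t : ℝ => √(max t 0 + η)).inv₀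
      fun t => (Real.sqrt_pos.2 (hpos t)).ne'
  refine ⟨cfc (fun t : ℝ => (√(max t 0 + η))⁻¹) y, cfc_predicate _ _, ?_⟩
  have h1 : y + algebraMap ℝ D η = cfc (fun t : ℝ => t + η) y := by
    rw [cfc_add_const η (fun t : ℝ => t) y, cfc_id' ℝ y]
  rw [h1, ← cfc_mul _ _ y hc.continuousOn, ← cfc_mul _ _ y _ hc.continuousOn, ← cfc_one ℝ y]
  · refine cfc_congr fun t ht => ?_
    have ht0 : 0 ≤ t := spectrum_nonneg_of_nonneg hy ht
    have h2 : √(t + η) ≠ 0 := (Real.sqrt_pos.2 (by positivity)).ne'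
    have h3 : √(t + η) * √(t + η) = t + η := Real.mul_self_sqrt (by positivity)
    simp only [max_eq_left ht0, Pi.one_apply]
    field_simp
    rw [sq, h3]
  · exact (hc.mul (by fun_prop)).continuousOn

theorem mem_closure_conj_of_le {x y : D} (hx : 0 ≤ x) (hxy : x ≤ y) :
    x ∈ closure (Set.range fun v : D => v * y * star v) := by
  rw [Metric.mem_closure_range_iff]
  intro ε hε
  obtain ⟨u, hu, hu1⟩ := exists_selfAdjoint_conj_add_eq_one (hx.trans hxy) (half_pos hε)
  set r := CFC.sqrt x with hr
  have hr0 : IsSelfAdjoint r := (CFC.sqrt_nonneg x).isSelfAdjoint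
  have hrr : r * r = x := CFC.sqrt_mul_sqrt_self x
  refine ⟨r * u, ?_⟩
  have h1 : u * y * u + (ε / 2) • (u * u) = 1 := by
    rw [← hu1, mul_add, add_mul, ← Algebra.commutes, mul_assoc _ u u, Algebra.smul_def]
  have h2 : x - r * u * y * star (r * u) = (ε / 2) • (r * u * star (r * u)) := by
    rw [star_mul, hr0.star_eq, hu.star_eq]
    have : r * (u * y * u + (ε / 2) • (u * u)) * r = r * 1 * r := by rw [h1]
    rw [mul_one, hrr, mul_add, add_mul] at this
    rw [← this]
    simp [mul_assoc]
  have h3 : ‖u * x * u‖ ≤ 1 := by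
    have h4 : u * x * u ≤ 1 := by
      rw [← h1]
      refine (hu.conjugate_le_conjugate hxy).trans (le_add_of_nonneg_right ?_)
      refine smul_nonneg (by positivity) ?_
      nth_rw 1 [← hu.star_eq]
      exact star_mul_self_nonneg u
    exact (CStarAlgebra.norm_le_one_iff_of_nonneg _ (hu.conjugate_nonneg hx)).2 h4
  rw [dist_eq_norm, h2, norm_smul, CStarRing.norm_self_mul_star,
    ← CStarRing.norm_star_mul_self, star_mul, hr0.star_eq, hu.star_eq]
  rw [show u * r * (r * u) = u * x * u by rw [← hrr]; simp [mul_assoc]]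
  rw [Real.norm_of_nonneg (by positivity)]
  nlinarith

/-- The positive cutoff `(a - ε)₊`. -/
noncomputable def cutoff (ε : ℝ) (a : D) : D := cfc (fun t : ℝ => max 0 (t - ε)) a

theorem cutoff_nonneg (ε : ℝ) (a : D) : 0 ≤ cutoff ε a := cfc_nonneg fun _ _ => le_max_left _ _

theorem norm_cutoff_sub_le {ε : ℝ} (hε : 0 ≤ ε) {a : D} (ha : 0 ≤ a) : ‖cutoff ε a - a‖ ≤ ε := by
  nth_rw 2 [← cfc_id' ℝ a]
  rw [cutoff, ← cfc_sub _ _ a (by fun_prop) (by fun_prop)]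
  refine norm_cfc_le hε fun t ht => ?_
  have := spectrum_nonneg_of_nonneg ha ht
  rw [Real.norm_eq_abs, abs_le]
  rcases max_cases 0 (t - ε) with h | h <;> constructor <;> linarith

/-- Rørdam's lemma. -/
theorem cutoff_mem_closure_conj {a z : D} (ha : IsSelfAdjoint a) (hz : 0 ≤ z) {ε : ℝ}
    (h : ‖a - z‖ < ε) : cutoff ε a ∈ closure (Set.range fun v : D => v * z * star v) := by
  set δ := ‖a - z‖ with hδ
  have h1 : a - algebraMap ℝ D δ ≤ z := by
    have := (ha.sub hz.isSelfAdjoint).le_algebraMap_norm_self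
    rw [← hδ] at this
    rw [sub_le_iff_le_add] at this ⊢
    rwa [add_comm]
  have hpos : ∀ t : ℝ, 0 < max (t - δ) (ε - δ) := fun t => lt_max_of_lt_right (by linarith)
  have hc : Continuous fun t : ℝ => √(max 0 (t - ε) / max (t - δ) (ε - δ)) :=
    Real.continuous_sqrt.comp (Continuous.div (by fun_prop) (by fun_prop) fun t => (hpos t).ne')
  set e := cfc (fun t : ℝ => √(max 0 (t - ε) / max (t - δ) (ε - δ))) a with he
  have he0 : IsSelfAdjoint e := cfc_predicate _ _
  have h2 : e * (a - algebraMap ℝ D δ) * e = cutoff ε a := by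
    have h3 : a - algebraMap ℝ D δ = cfc (fun t : ℝ => t - δ) a := by
      rw [cfc_sub (fun t : ℝ => t) (fun _ => δ) a, cfc_id' ℝ a, cfc_const δ a]
    rw [h3, he, ← cfc_mul _ _ a hc.continuousOn, ← cfc_mul _ _ a _ hc.continuousOn]
    · refine cfc_congr fun t _ => ?_
      have h4 : √(max 0 (t - ε) / max (t - δ) (ε - δ)) * √(max 0 (t - ε) / max (t - δ) (ε - δ))
        = max 0 (t - ε) / max (t - δ) (ε - δ) :=
        Real.mul_self_sqrt (div_nonneg (le_max_left _ _) (hpos t).le)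
      change √(max 0 (t - ε) / max (t - δ) (ε - δ)) * (t - δ) *
        √(max 0 (t - ε) / max (t - δ) (ε - δ)) = max 0 (t - ε)
      rw [mul_right_comm, h4]
      rcases le_total t ε with hle | hle
      · rw [max_eq_left (by linarith)]; simp
      · rw [max_eq_left (by linarith : ε - δ ≤ t - δ), div_mul_cancel₀ _ (by linarith)]
    · exact (hc.mul (by fun_prop)).continuousOn
  refine mem_closure_conj_trans (y := e * z * e)
    (mem_closure_conj_of_le (cutoff_nonneg _ _) ?_) (subset_closure ⟨e, by simp [he0.star_eq]⟩)
  rw [← h2]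
  exact he0.conjugate_le_conjugate h1

theorem exists_conj_one_sub {h : D} (h0 : 0 ≤ h) :
    ∃ w : D, IsSelfAdjoint w ∧ w * (1 - h) * w = 1 - h * h := by
  refine ⟨cfc (fun t : ℝ => √(1 + t)) h, cfc_predicate _ _, ?_⟩
  have h1 : 1 - h = cfc (fun t : ℝ => 1 - t) h := by
    rw [cfc_sub (fun _ : ℝ => 1) (fun t => t) h, cfc_id' ℝ h, cfc_const 1 h, map_one]
  have h2 : 1 - h * h = cfc (fun t : ℝ => 1 - t * t) h := by
    rw [cfc_sub (fun _ : ℝ => 1) (fun t => t * t) h, cfc_mul (fun t : ℝ => t) (fun t => t) h,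
      cfc_id' ℝ h, cfc_const 1 h, map_one]
  rw [h1, h2, ← cfc_mul _ _ h, ← cfc_mul _ _ h]
  refine cfc_congr fun t ht => ?_
  have ht0 : 0 ≤ t := spectrum_nonneg_of_nonneg h0 ht
  have h3 : √(1 + t) * √(1 + t) = 1 + t := Real.mul_self_sqrt (by positivity)
  linear_combination (1 - t) * h3
end CStar

section Flat

variable {A : Type*} {I J K L M P : Type}

/-- Flatten a matrix of matrices. -/
abbrev flat (x : Matrix I J (Matrix K L A)) : Matrix (I × K) (J × L) A :=
  Matrix.comp I J K L A x

theorem flat_mul [Ring A] [Fintype J] [Fintype L] (x : Matrix I J (Matrix K L A))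
    (y : Matrix J M (Matrix L P A)) (z : Matrix I M (Matrix K P A))
    (hz : ∀ i k, z i k = ∑ j, x i j * y j k) :
    flat z = flat x * flat y := by
  ext ⟨i, k⟩ ⟨j, l⟩
  simp [Matrix.mul_apply, Matrix.sum_apply, Fintype.sum_prod_type, hz]

theorem flat_conjTranspose [Star A] (x : Matrix I J (Matrix K K A)) : flat xᴴ = (flat x)ᴴ := by
  ext ⟨i, k⟩ ⟨j, l⟩
  simp [Matrix.conjTranspose_apply, Matrix.star_apply]

end Flat

section MatCuntz

variable {A : Type*} [NormedRing A] [StarRing A]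
  {I J K L : Type} [Fintype I] [Fintype J] [Fintype K] [Fintype L]

theorem matCuntzLE_univ_iff {x : Matrix I I A} {y : Matrix J J A} :
    MatCuntzLE Set.univ x y ↔ x ∈ closure (Set.range fun v : Matrix I J A => v * y * vᴴ) := by
  have : FrechetUrysohnSpace (Matrix I I A) :=
    inferInstanceAs (FrechetUrysohnSpace (I → I → A))
  rw [mem_closure_iff_seq_limit]
  constructor
  · rintro ⟨v, -, hv⟩
    exact ⟨fun t => v t * y * (v t)ᴴ, fun t => ⟨v t, rfl⟩, tendsto_iff_norm_sub_tendsto_zero.2 hv⟩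
  · rintro ⟨w, hw, hlim⟩
    choose v hv using hw
    refine ⟨v, fun _ _ _ => trivial, ?_⟩
    simpa only [← hv] using tendsto_iff_norm_sub_tendsto_zero.1 hlim

theorem MatCuntzLE.trans {x : Matrix I I A} {y : Matrix J J A} {z : Matrix K K A}
    (hxy : MatCuntzLE Set.univ x y) (hyz : MatCuntzLE Set.univ y z) :
    MatCuntzLE Set.univ x z := by
  rw [matCuntzLE_univ_iff] at *
  refine closure_minimal ?_ isClosed_closure hxy
  rintro _ ⟨w, rfl⟩
  refine map_mem_closure (f := fun y => w * y * wᴴ) (by fun_prop) hyz ?_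
  rintro _ ⟨v, rfl⟩
  exact ⟨w * v, by simp [Matrix.mul_assoc, Matrix.conjTranspose_mul]⟩

theorem matCuntzLE_conj (w : Matrix I J A) (y : Matrix J J A) :
    MatCuntzLE Set.univ (w * y * wᴴ) y :=
  matCuntzLE_univ_iff.2 (subset_closure ⟨w, rfl⟩)

theorem matCuntzLE_submatrix (y : Matrix J J A) (e : I → J) :
    MatCuntzLE Set.univ (y.submatrix e e) y := by
  classical
  have h := matCuntzLE_conj ((1 : Matrix J J A).submatrix e id) y
  rwa [Matrix.conjTranspose_submatrix, Matrix.conjTranspose_one,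
    ← Matrix.submatrix_id_id y, ← Matrix.submatrix_mul _ _ _ _ _ Function.bijective_id,
    ← Matrix.submatrix_mul _ _ _ _ _ Function.bijective_id, one_mul, mul_one] at h

theorem MatCuntzLE.fromBlocks {x : Matrix I I A} {y : Matrix J J A} {x' : Matrix K K A}
    {y' : Matrix L L A} (h : MatCuntzLE Set.univ x y) (h' : MatCuntzLE Set.univ x' y') :
    MatCuntzLE Set.univ (Matrix.fromBlocks x 0 0 x') (Matrix.fromBlocks y 0 0 y') := by
  rw [matCuntzLE_univ_iff] at *
  refine map_mem_closure₂ (f := fun a b => Matrix.fromBlocks a 0 0 b) (by fun_prop) h h' ?_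
  rintro _ ⟨v, rfl⟩ _ ⟨w, rfl⟩
  exact ⟨Matrix.fromBlocks v 0 0 w, by
    simp [Matrix.fromBlocks_multiply, Matrix.fromBlocks_conjTranspose]⟩

theorem MatCuntzLE.flat [DecidableEq K] {S : Set (Matrix K K A)} {x : Matrix I I (Matrix K K A)}
    {y : Matrix J J (Matrix K K A)} (h : MatCuntzLE S x y) :
    MatCuntzLE Set.univ (_root_.flat x) (_root_.flat y) := by
  obtain ⟨v, -, hv⟩ := h
  refine ⟨fun t => _root_.flat (v t), fun _ _ _ => trivial, ?_⟩
  have h1 : Tendsto (fun t => v t * y * (v t)ᴴ) atTop (nhds x) :=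
    tendsto_iff_norm_sub_tendsto_zero.2 hv
  have hc : Continuous fun z : Matrix I I (Matrix K K A) => _root_.flat z := by
    refine continuous_pi fun p => continuous_pi fun q => ?_
    exact (continuous_id.matrix_elem p.1 q.1).matrix_elem p.2 q.2
  have h2 := (hc.tendsto x).comp h1
  refine tendsto_iff_norm_sub_tendsto_zero.1 (h2.congr fun t => ?_)
  rw [← flat_conjTranspose, ← flat_mul (v t) y (v t * y) (fun _ _ => rfl)]
  exact flat_mul _ _ _ (fun _ _ => rfl)

end MatCuntz

section Polynomials

theorem exists_polynomial_seq_near {f : ℝ → ℝ} (hf : Continuous f) (hf0 : f 0 = 0) {M : ℝ}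
    (hM : 0 ≤ M) :
    ∃ q : ℕ → Polynomial ℝ, (∀ j, (q j).eval 0 = 0) ∧
      ∀ δ : ℝ, 0 < δ → ∃ J : ℕ, ∀ j ≥ J, ∀ t ∈ Set.Icc (0 : ℝ) M, |(q j).eval t - f t| < δ := by
  have h : ∀ j : ℕ, ∃ p : Polynomial ℝ, ∀ t ∈ Set.Icc (0 : ℝ) M,
      |p.eval t - f t| < 1 / ((j : ℝ) + 1) := fun j =>
    exists_polynomial_near_of_continuousOn 0 M f hf.continuousOn _ Nat.one_div_pos_of_nat
  choose p hp using h
  refine ⟨fun j => p j - Polynomial.C ((p j).eval 0), fun j => by simp, fun δ hδ => ?_⟩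
  obtain ⟨J, hJ⟩ := exists_nat_one_div_lt (half_pos hδ)
  refine ⟨J, fun j hj t ht => ?_⟩
  have h1 := (hp j t ht).trans_le (Nat.one_div_le_one_div hj)
  have h2 := (hp j 0 ⟨le_rfl, hM⟩).trans_le (Nat.one_div_le_one_div hj)
  rw [hf0, sub_zero] at h2
  rw [Polynomial.eval_sub, Polynomial.eval_C]
  calc |(p j).eval t - (p j).eval 0 - f t| = |((p j).eval t - f t) - (p j).eval 0| := by ring_nf
    _ ≤ |(p j).eval t - f t| + |(p j).eval 0| := abs_sub _ _
    _ < δ := by linarith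

variable {D : Type*} [CStarAlgebra D]

theorem tendsto_aeval_cfc {a : D} (ha : IsSelfAdjoint a) {M : ℝ}
    (hM : spectrum ℝ a ⊆ Set.Icc 0 M) {f : ℝ → ℝ} (hf : Continuous f) {q : ℕ → Polynomial ℝ}
    (hq : ∀ δ : ℝ, 0 < δ → ∃ J : ℕ, ∀ j ≥ J, ∀ t ∈ Set.Icc (0 : ℝ) M, |(q j).eval t - f t| < δ) :
    Tendsto (fun j => Polynomial.aeval a (q j)) atTop (nhds (cfc f a)) := by
  rw [Metric.tendsto_atTop]
  intro ε hε
  obtain ⟨J, hJ⟩ := hq ε hε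
  refine ⟨J, fun j hj => ?_⟩
  rw [dist_eq_norm, ← cfc_polynomial (q j) a,
    ← cfc_sub _ _ a (q j).continuous.continuousOn hf.continuousOn]
  exact norm_cfc_lt hε fun t ht => hJ j hj t (hM ht)

theorem aeval_mem_of_eval_zero {S : NonUnitalStarSubalgebra ℂ D} {a : D} (ha : a ∈ S)
    {q : Polynomial ℝ} (hq : q.eval 0 = 0) : Polynomial.aeval a q ∈ S := by
  obtain ⟨p, rfl⟩ := Polynomial.X_dvd_iff.2 ((Polynomial.coeff_zero_eq_eval_zero q).trans hq)
  clear hq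
  induction p using Polynomial.induction_on' with
  | add p q hp hq =>
    rw [mul_add, map_add]
    exact add_mem hp hq
  | monomial n r =>
    have hpow : ∀ n : ℕ, a ^ (n + 1) ∈ S := fun n => by
      induction n with
      | zero => simpa using ha
      | succ n ih => rw [pow_succ]; exact mul_mem ih ha
    rw [Polynomial.X_mul_monomial, Polynomial.aeval_monomial, ← Algebra.smul_def,
      ← Complex.coe_smul]
    exact SMulMemClass.smul_mem _ (hpow n)

variable [PartialOrder D] [StarOrderedRing D]

theorem spectrum_subset_Icc_norm {a : D} (ha : 0 ≤ a) :
    spectrum ℝ a ⊆ Set.Icc 0 (‖a‖ * ‖(1 : D)‖) := fun _ ht =>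
  ⟨spectrum_nonneg_of_nonneg ha ht, (le_abs_self _).trans (spectrum.norm_le_norm_mul_of_mem ht)⟩

theorem cfc_mem_of_isClosed {S : NonUnitalStarSubalgebra ℂ D} (hS : IsClosed (S : Set D)) {a : D}
    (ha : a ∈ S) (ha0 : 0 ≤ a) {f : ℝ → ℝ} (hf : Continuous f) (hf0 : f 0 = 0) : cfc f a ∈ S := by
  obtain ⟨q, hq0, hq⟩ := exists_polynomial_seq_near hf hf0
    (by positivity : 0 ≤ ‖a‖ * ‖(1 : D)‖)
  exact hS.mem_of_tendsto
    (tendsto_aeval_cfc ha0.isSelfAdjoint (spectrum_subset_Icc_norm ha0) hf hq)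
    (Eventually.of_forall fun j => aeval_mem_of_eval_zero ha (hq0 j))

theorem exists_cutoff_eq_star_mul_self {S : NonUnitalStarSubalgebra ℂ D}
    (hS : IsClosed (S : Set D)) {a : D} (ha : a ∈ S) (ha0 : 0 ≤ a) {ε : ℝ} (hε : 0 ≤ ε) :
    ∃ u ∈ S, cutoff ε a = star u * u := by
  refine ⟨cfc (fun t : ℝ => √(max 0 (t - ε))) a,
    cfc_mem_of_isClosed hS ha ha0 (by fun_prop) (by simp [hε]), ?_⟩
  have h : IsSelfAdjoint (cfc (fun t : ℝ => √(max 0 (t - ε))) a) := cfc_predicate _ _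
  rw [h.star_eq, ← cfc_mul _ _ a]
  exact cfc_congr fun t _ => (Real.mul_self_sqrt (le_max_left _ _)).symm

omit [PartialOrder D] [StarOrderedRing D] in
theorem norm_mul_star_sub_lt {x y : D} {R δ : ℝ} (hx : ‖x‖ ≤ R)
    (hxy : ‖x - y‖ < min 1 (δ / (2 * R + 1))) : ‖x * star x - y * star y‖ < δ := by
  have hR : 0 ≤ R := (norm_nonneg x).trans hx
  have h1 := hxy.trans_le (min_le_left _ _)
  have h2 := (lt_div_iff₀ (by positivity)).1 (hxy.trans_le (min_le_right _ _))
  have hy : ‖y‖ ≤ R + 1 := by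
    have := norm_sub_norm_le y x
    rw [norm_sub_rev] at this
    linarith
  calc ‖x * star x - y * star y‖ = ‖x * star (x - y) + (x - y) * star y‖ := by
        rw [star_sub]; congr 1; noncomm_ring
    _ ≤ ‖x‖ * ‖x - y‖ + ‖x - y‖ * ‖y‖ := by
        refine (norm_add_le _ _).trans (add_le_add ?_ ?_)
        · simpa only [norm_star] using norm_mul_le x (star (x - y))
        · simpa only [norm_star] using norm_mul_le (x - y) (star y)
    _ ≤ ‖x - y‖ * (2 * R + 1) := by nlinarith [norm_nonneg (x - y)]
    _ < δ := h2

/-- Approximate compression of `star r * r` by `h` inside a closed star subalgebra. -/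
theorem exists_mem_cutoff_near {S : NonUnitalStarSubalgebra ℂ D} (hS : IsClosed (S : Set D))
    {h r c : D} (h0 : 0 ≤ h) (h1 : ‖h‖ ≤ 1) (hc : c ∈ S) {δ : ℝ} (hδ : 0 < δ)
    (hrc : ‖h * star r - c‖ < min 1 (δ / (2 * ‖r‖ + 1))) :
    ∃ u ∈ S, star u * u ∈ closure (Set.range fun v : D => v * (star r * r) * star v) ∧
      ‖cutoff δ (star u * u) - h * (star r * r) * h‖ < 3 * δ := by
  have hcc : 0 ≤ c * star c := mul_star_self_nonneg c
  obtain ⟨u, hu, huc⟩ := exists_cutoff_eq_star_mul_self hS (mul_mem hc (star_mem hc)) hcc hδ.le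
  have hx : h * star r * star (h * star r) = h * (star r * r) * h := by
    simp [h0.isSelfAdjoint.star_eq, mul_assoc]
  have hR : ‖h * star r‖ ≤ ‖r‖ := (norm_mul_le _ _).trans (by
    rw [norm_star]; exact mul_le_of_le_one_left (norm_nonneg _) h1)
  have h2 := norm_mul_star_sub_lt hR hrc
  rw [hx] at h2
  refine ⟨u, hu, ?_, ?_⟩
  · rw [← huc]
    refine mem_closure_conj_trans (cutoff_mem_closure_conj hcc.isSelfAdjoint
      (h0.isSelfAdjoint.conjugate_nonneg (star_mul_self_nonneg r)) (by rwa [norm_sub_rev])) ?_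
    exact subset_closure ⟨h, by simp [h0.isSelfAdjoint.star_eq]⟩
  · have h3 := norm_cutoff_sub_le hδ.le (star_mul_self_nonneg u)
    have h4 := norm_cutoff_sub_le hδ.le hcc
    rw [huc] at h4
    rw [norm_sub_rev] at h2
    have h5 := norm_add₃_le (a := cutoff δ (star u * u) - star u * u)
      (b := star u * u - c * star c) (c := c * star c - h * (star r * r) * h)
    rw [show cutoff δ (star u * u) - star u * u + (star u * u - c * star c) +
      (c * star c - h * (star r * r) * h) = cutoff δ (star u * u) - h * (star r * r) * h by abel]
      at h5
    linarith

end Polynomials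

section Transfer

theorem exists_eq_star_mul_self {D : Type*} [CStarAlgebra D] [PartialOrder D] [StarOrderedRing D]
    {x : D} (h : 0 ≤ x) : ∃ y, x = star y * y :=
  ⟨CFC.sqrt x, by rw [(CFC.sqrt_nonneg x).star_eq, CFC.sqrt_mul_sqrt_self x h]⟩

variable {D : Type*} [CStarAlgebra D] {R : Type*} [Ring R] [Algebra ℝ R] [NormedAddCommGroup R]

theorem IsCutoff.map_eq_cutoff {φ : R ≃ₐ[ℝ] D}
    (hφ : ∀ (z : ℕ → R) (w : R), Tendsto (fun j => ‖z j - w‖) atTop (nhds 0) →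
      Tendsto (fun j => φ (z j)) atTop (nhds (φ w)))
    {ε M : ℝ} {a b : R} (h : IsCutoff ε M a b) (ha : IsSelfAdjoint (φ a)) :
    φ b = cutoff ε (φ a) := by
  obtain ⟨hM, q, -, hq, hlim⟩ := h
  rw [← AlgEquiv.spectrum_eq φ] at hM
  refine tendsto_nhds_unique (hφ _ _ hlim) ?_
  simp_rw [← Polynomial.aeval_algHom_apply φ]
  exact tendsto_aeval_cfc ha hM (by fun_prop) hq

theorem exists_isCutoff [PartialOrder D] [StarOrderedRing D] {φ : R ≃ₐ[ℝ] D}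
    (hφ : ∀ (z : ℕ → R) (w : R), Tendsto (fun j => φ (z j)) atTop (nhds (φ w)) →
      Tendsto (fun j => ‖z j - w‖) atTop (nhds 0))
    {ε : ℝ} (hε : 0 ≤ ε) {a : R} (ha : 0 ≤ φ a) :
    ∃ M, IsCutoff ε M a (φ.symm (cutoff ε (φ a))) := by
  have hM := spectrum_subset_Icc_norm ha
  obtain ⟨q, hq0, hq⟩ := exists_polynomial_seq_near (f := fun t : ℝ => max 0 (t - ε))
    (by fun_prop) (by simp [hε]) (by positivity : 0 ≤ ‖φ a‖ * ‖(1 : D)‖)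
  refine ⟨_, by rwa [AlgEquiv.spectrum_eq φ] at hM, q, hq0, hq, hφ _ _ ?_⟩
  rw [φ.apply_symm_apply]
  simp_rw [← Polynomial.aeval_algHom_apply φ]
  exact tendsto_aeval_cfc ha.isSelfAdjoint hM (by fun_prop) hq

end Transfer

section CStarMatrix

variable {A : Type*} [CStarAlgebra A] {k : ℕ}

/-- Matrices over a C⋆-algebra, as a real algebra, are the C⋆-algebra of matrices. -/
noncomputable def toCStarMatrix (A : Type*) [CStarAlgebra A] (k : ℕ) :
    Matrix (Fin k) (Fin k) A ≃ₐ[ℝ] CStarMatrix (Fin k) (Fin k) A :=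
  AlgEquiv.ofRingEquiv (f := CStarMatrix.ofMatrixRingEquiv) fun _ => rfl

theorem toCStarMatrix_star (x : Matrix (Fin k) (Fin k) A) :
    toCStarMatrix A k (star x) = star (toCStarMatrix A k x) := rfl

theorem continuous_toCStarMatrix : Continuous (toCStarMatrix A k) := continuous_id

theorem continuous_toCStarMatrix_symm : Continuous (toCStarMatrix A k).symm := continuous_id

theorem cuntzG_of_mem_closure {x y : CStarMatrix (Fin k) (Fin k) A}
    (h : x ∈ closure (Set.range fun v : CStarMatrix (Fin k) (Fin k) A => v * y * star v)) :
    MatCuntzLE Set.univ ((toCStarMatrix A k).symm x) ((toCStarMatrix A k).symm y) :=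
  matCuntzLE_univ_iff.2 h

theorem tendsto_toCStarMatrix_iff (z : ℕ → Matrix (Fin k) (Fin k) A)
    (w : Matrix (Fin k) (Fin k) A) :
    Tendsto (fun j => toCStarMatrix A k (z j)) atTop (nhds (toCStarMatrix A k w)) ↔
      Tendsto (fun j => ‖z j - w‖) atTop (nhds 0) := by
  rw [← tendsto_iff_norm_sub_tendsto_zero]
  exact ⟨fun h => (continuous_toCStarMatrix_symm.tendsto _).comp h,
    fun h => (continuous_toCStarMatrix.tendsto _).comp h⟩

variable [PartialOrder A] [StarOrderedRing A]

theorem norm_symm_le (x : CStarMatrix (Fin k) (Fin k) A) :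
    ‖(toCStarMatrix A k).symm x‖ ≤ ‖x‖ :=
  (Matrix.norm_le_iff (norm_nonneg _)).2 fun _ _ => CStarMatrix.norm_entry_le_norm

theorem exists_norm_toCStarMatrix_lt (A : Type*) [CStarAlgebra A] [PartialOrder A]
    [StarOrderedRing A] (k : ℕ) {ε : ℝ} (hε : 0 < ε) :
    ∃ δ > 0, ∀ x : Matrix (Fin k) (Fin k) A, ‖x‖ < δ → ‖toCStarMatrix A k x‖ < ε := by
  obtain ⟨δ, hδ, h⟩ := Metric.continuous_iff.1
    (continuous_toCStarMatrix (A := A) (k := k)) 0 ε hε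
  exact ⟨δ, hδ, fun x hx => by simpa using h x (by simpa using hx)⟩

theorem StarPos.nonneg {x : Matrix (Fin k) (Fin k) A} (h : StarPos x) :
    0 ≤ toCStarMatrix A k x := by
  obtain ⟨y, rfl⟩ := h
  exact star_mul_self_nonneg (toCStarMatrix A k y)

theorem starPos_of_nonneg {x : Matrix (Fin k) (Fin k) A} (h : 0 ≤ toCStarMatrix A k x) :
    StarPos x := by
  obtain ⟨y, hy⟩ := exists_eq_star_mul_self h
  exact ⟨(toCStarMatrix A k).symm y, hy⟩

/-- One by one matrices are scalars. -/
def finOneAlgEquiv (R : Type*) [Ring R] [Algebra ℝ R] : Matrix (Fin 1) (Fin 1) R ≃ₐ[ℝ] R :=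
  AlgEquiv.ofRingEquiv
    (f := { toFun := fun x => x 0 0
            invFun := fun x => Matrix.of fun _ _ => x
            left_inv := fun x => Matrix.ext fun i j => by
              rw [Subsingleton.elim i 0, Subsingleton.elim j 0]; rfl
            right_inv := fun _ => rfl
            map_mul' := fun x y => (Matrix.mul_apply (M := x) (N := y)).trans (Fin.sum_univ_one _)
            map_add' := fun _ _ => rfl })
    fun r => (Matrix.algebraMap_matrix_apply (n := Fin 1) (r := r) (i := 0) (j := 0)).trans
      (if_pos rfl)

theorem exists_isCutoff_oneByOne {x : Matrix (Fin k) (Fin k) A} (hx : 0 ≤ toCStarMatrix A k x)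
    {ε : ℝ} (hε : 0 ≤ ε) :
    ∃ M, IsCutoff ε M (Matrix.of fun _ _ : Fin 1 => x)
      (Matrix.of fun _ _ : Fin 1 => (toCStarMatrix A k).symm (cutoff ε (toCStarMatrix A k x))) := by
  refine exists_isCutoff (φ := (finOneAlgEquiv _).trans (toCStarMatrix A k)) ?_ hε
    (a := Matrix.of fun _ _ : Fin 1 => x) hx
  intro z w h
  have h1 : Tendsto (fun j => z j 0 0) atTop (nhds (w 0 0)) :=
    (continuous_toCStarMatrix_symm.tendsto _).comp h
  refine tendsto_iff_norm_sub_tendsto_zero.1 (tendsto_pi_nhds.2 fun i => tendsto_pi_nhds.2 ?_)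
  intro j
  rw [Subsingleton.elim i 0, Subsingleton.elim j 0]
  exact h1

end CStarMatrix

section Approximation

variable {A : Type*} [CStarAlgebra A] {k : ℕ}

/-- A star subalgebra of matrices, inside the C⋆-algebra of matrices. -/
def NonUnitalStarSubalgebra.toCStarMatrix
    (B : NonUnitalStarSubalgebra ℂ (Matrix (Fin k) (Fin k) A)) :
    NonUnitalStarSubalgebra ℂ (CStarMatrix (Fin k) (Fin k) A) where
  carrier := {x | (_root_.toCStarMatrix A k).symm x ∈ B}
  add_mem' hx hy := by simpa using add_mem hx hy
  zero_mem' := by simp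
  mul_mem' hx hy := by simpa using mul_mem hx hy
  smul_mem' c _ hx := B.smul_mem' c hx
  star_mem' hx := B.star_mem' hx

theorem NonUnitalStarSubalgebra.map_mem_toCStarMatrix
    {B : NonUnitalStarSubalgebra ℂ (Matrix (Fin k) (Fin k) A)} {x : Matrix (Fin k) (Fin k) A} :
    _root_.toCStarMatrix A k x ∈ B.toCStarMatrix ↔ x ∈ B := Iff.rfl

theorem matCuntzLE_flat_oneByOne (x : Matrix (Fin k) (Fin k) A) :
    MatCuntzLE Set.univ (flat (Matrix.of fun _ _ : Fin 1 => x)) x :=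
  matCuntzLE_submatrix x Prod.snd

theorem matCuntzLE_of_flat_oneByOne (x : Matrix (Fin k) (Fin k) A) :
    MatCuntzLE Set.univ x (flat (Matrix.of fun _ _ : Fin 1 => x)) :=
  matCuntzLE_submatrix (flat (Matrix.of fun _ _ : Fin 1 => x)) fun i => (0, i)

variable [PartialOrder A] [StarOrderedRing A]

theorem exists_divisible_approximation {m n : ℕ}
    {Ω : Set (NonUnitalStarSubalgebra ℂ (Matrix (Fin k) (Fin k) A) × Matrix (Fin k) (Fin k) A)}
    (hdiv : ∀ Bp ∈ Ω, WeaklyDivOn (Bp.1 : Set (Matrix (Fin k) (Fin k) A)) m n)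
    (hW : WTAMemG Ω) (r : Matrix (Fin k) (Fin k) A) {s : Matrix (Fin k) (Fin k) A}
    (hs : StarPos s) (hs0 : s ≠ 0) {δ : ℝ} (hδ : 0 < δ) :
    ∃ (h e : Matrix (Fin k) (Fin k) A) (K : ℕ)
      (N : Fin n → Matrix (Fin K) (Fin K) (Matrix (Fin k) (Fin k) A)),
      0 ≤ toCStarMatrix A k h ∧ 0 ≤ toCStarMatrix A k (1 - h) ∧ 0 ≤ toCStarMatrix A k e ∧
      ‖toCStarMatrix A k (e - h * (star r * r) * h)‖ < 3 * δ ∧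
      ‖toCStarMatrix A k (h * (star r * r) * h - star r * (h * h) * r)‖ < δ ∧
      ‖s‖ - δ ≤ ‖h * s * h‖ ∧
      (∀ j, MatCuntzLE Set.univ
        (flat (Matrix.blockDiagonal fun _ : Fin m => star (N j) * N j)) (star r * r)) ∧
      MatCuntzLE Set.univ e (flat (Matrix.blockDiagonal fun j => star (N j) * N j)) ∧
      MatCuntzLE Set.univ (1 - h) s := by
  set φ := toCStarMatrix A k with hφ
  obtain ⟨η, hη, hηφ⟩ := exists_norm_toCStarMatrix_lt A k
    (ε := min 1 (δ / (2 * ‖φ r‖ + 1))) (by positivity)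
  obtain ⟨p, g, B, hB, hBc, hp, hpp, hg, hg1, hgB, hpB, hBu, hF, hcomm, ⟨v, hv⟩, hnorm⟩ :=
    hW {star r} (min η δ) (lt_min hη hδ) s hs hs0
  obtain ⟨⟨c, hcB, hc⟩, -⟩ := hF _ (Finset.mem_singleton_self _)
  have hcomm := hcomm _ (Finset.mem_singleton_self _)
  set h := p - g with hh
  have h0 : 0 ≤ φ h := by
    have h1 : h = star p * (1 - g) * p := by
      rw [hp.star_eq, mul_sub, sub_mul, mul_one, hpp.eq, (hBu g hgB).1, (hBu g hgB).2]
    rw [h1, map_mul, map_mul, hφ, toCStarMatrix_star]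
    exact star_left_conjugate_nonneg hg1.nonneg _
  have h1 : 0 ≤ φ (1 - h) := by
    have h1 : 1 - h = star (1 - p) * (1 - p) + g := by
      rw [star_sub, star_one, hp.star_eq, hpp.one_sub.eq, hh]; abel
    rw [h1, map_add]
    exact add_nonneg (StarPos.nonneg ⟨1 - p, rfl⟩) hg.nonneg
  have hn : ‖φ h‖ ≤ 1 := by
    rw [map_sub, map_one, sub_nonneg] at h1
    exact (CStarAlgebra.norm_le_one_iff_of_nonneg _ h0).2 h1
  have hS : IsClosed (B.toCStarMatrix : Set (CStarMatrix (Fin k) (Fin k) A)) :=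
    IsClosed.preimage (continuous_toCStarMatrix_symm (A := A) (k := k)) hBc
  have hc' := hηφ _ (hc.trans_le (min_le_left _ _))
  rw [map_sub, map_mul, toCStarMatrix_star] at hc'
  obtain ⟨u, huS, hur, hucut⟩ := exists_mem_cutoff_near hS h0 hn
    (c := φ c) (NonUnitalStarSubalgebra.map_mem_toCStarMatrix.2 hcB) hδ hc'
  obtain ⟨u, rfl⟩ := φ.surjective u
  have huB : u ∈ B := NonUnitalStarSubalgebra.map_mem_toCStarMatrix.1 huS
  obtain ⟨M, hM⟩ := exists_isCutoff_oneByOne (StarPos.nonneg ⟨u, rfl⟩) hδ.le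
  obtain ⟨K, x, -, hx, hxm, hxn⟩ := hdiv _ hB 1 (Matrix.of fun _ _ => star u * u)
    (fun _ _ => mul_mem (star_mem huB) huB)
    ⟨Matrix.of fun _ _ => u, fun _ _ => huB, by
      ext1 i j; simp [Matrix.mul_apply, Matrix.star_apply]⟩ δ hδ
  choose N _ hN using hx
  obtain rfl : x = fun j => star (N j) * N j := funext hN
  refine ⟨h, φ.symm (cutoff δ (φ (star u * u))), K, N, h0, h1, ?_, ?_, ?_, ?_, ?_, ?_,
    ⟨v, fun _ _ _ => trivial, hv⟩⟩
  · rw [φ.apply_symm_apply]; exact cutoff_nonneg _ _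
  · rw [map_sub, φ.apply_symm_apply, map_mul, map_mul, map_mul, map_mul, hφ, toCStarMatrix_star,
      toCStarMatrix_star]
    exact hucut
  · have hcomm' := hηφ _ (hcomm.trans_le (min_le_left _ _))
    rw [map_sub, map_mul, map_mul, toCStarMatrix_star] at hcomm'
    have hR : ‖φ h * star (φ r)‖ ≤ ‖φ r‖ := by
      calc ‖φ h * star (φ r)‖ ≤ ‖φ h‖ * ‖star (φ r)‖ := norm_mul_le _ _
        _ ≤ 1 * ‖φ r‖ := by rw [norm_star]; gcongr
        _ = ‖φ r‖ := one_mul _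
    have h2 := norm_mul_star_sub_lt hR hcomm'
    rw [star_mul, star_mul, star_star, h0.isSelfAdjoint.star_eq] at h2
    rw [map_sub, map_mul, map_mul, map_mul, map_mul, map_mul, map_mul, hφ, toCStarMatrix_star]
    simpa only [mul_assoc] using h2
  · exact (sub_le_sub_left (min_le_right _ _) _).trans hnorm
  · intro j
    refine (hxm j).flat.trans ((matCuntzLE_flat_oneByOne _).trans ?_)
    have := cuntzG_of_mem_closure hur
    simp only [hφ, ← toCStarMatrix_star, ← map_mul, AlgEquiv.symm_apply_apply] at this
    exact this
  · exact (matCuntzLE_of_flat_oneByOne _).trans (hxn M _ hM).flat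

end Approximation

section Divisibility

variable {A : Type*} [CStarAlgebra A] {k : ℕ}

theorem MatCuntzLE.eq_zero {I J : Type} [Fintype I] [Fintype J] {x : Matrix I I A}
    (h : MatCuntzLE Set.univ x (0 : Matrix J J A)) : x = 0 := by
  obtain ⟨v, -, hv⟩ := h
  have : ‖x‖ = 0 := by simpa using hv
  exact norm_eq_zero.1 this

variable [PartialOrder A] [StarOrderedRing A]

theorem starPos_star_mul_self_apply {K : ℕ}
    (N : Matrix (Fin K) (Fin K) (Matrix (Fin k) (Fin k) A)) (i : Fin K) :
    StarPos ((star N * N) i i) := by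
  refine starPos_of_nonneg ?_
  rw [Matrix.mul_apply, map_sum]
  exact Finset.sum_nonneg fun l _ => StarPos.nonneg ⟨N l i, rfl⟩

theorem exists_star_mul_self_apply_ne_zero {K : ℕ}
    {N : Matrix (Fin K) (Fin K) (Matrix (Fin k) (Fin k) A)} (hN : star N * N ≠ 0) :
    ∃ i, (star N * N) i i ≠ 0 := by
  contrapose! hN
  suffices N = 0 by simp [this]
  ext1 l i
  have h := congrArg (toCStarMatrix A k) (hN i)
  rw [Matrix.mul_apply, map_sum, map_zero] at h
  have h2 := (Finset.sum_eq_zero_iff_of_nonneg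
    (f := fun l => toCStarMatrix A k (star (N l i) * N l i))
    fun l _ => StarPos.nonneg ⟨N l i, rfl⟩).1 h l (Finset.mem_univ l)
  rw [map_mul, toCStarMatrix_star, CStarRing.star_mul_self_eq_zero_iff] at h2
  exact (map_eq_zero_iff _ (toCStarMatrix A k).injective).1 h2

theorem exists_blockDiagonal_matCuntzLE {m n : ℕ}
    {Ω : Set (NonUnitalStarSubalgebra ℂ (Matrix (Fin k) (Fin k) A) × Matrix (Fin k) (Fin k) A)}
    (hdiv : ∀ Bp ∈ Ω, WeaklyDivOn (Bp.1 : Set (Matrix (Fin k) (Fin k) A)) m n)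
    (hW : WTAMemG Ω) {r : Matrix (Fin k) (Fin k) A} (hr : star r * r ≠ 0) :
    ∃ s : Matrix (Fin k) (Fin k) A, StarPos s ∧ s ≠ 0 ∧
      MatCuntzLE Set.univ (Matrix.blockDiagonal fun _ : Fin m => s) (star r * r) := by
  have hpos := norm_pos_iff.2 hr
  obtain ⟨h, e, K, N, -, -, -, he, -, hnorm, hm, hn, -⟩ :=
    exists_divisible_approximation hdiv hW r ⟨r, rfl⟩ hr (δ := ‖star r * r‖ / 8) (by positivity)
  have he0 : e ≠ 0 := by
    rintro rfl
    rw [zero_sub, map_neg, norm_neg] at he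
    have h2 := norm_symm_le (toCStarMatrix A k (h * (star r * r) * h))
    rw [AlgEquiv.symm_apply_apply] at h2
    linarith
  obtain ⟨j, hj⟩ : ∃ j, star (N j) * N j ≠ 0 := by
    by_contra! hN
    refine he0 (MatCuntzLE.eq_zero (J := (Fin K × Fin n) × Fin k) ?_)
    convert hn
    ext ⟨⟨i, j⟩, l⟩ ⟨⟨i', j'⟩, l'⟩
    simp [hN, Matrix.blockDiagonal_apply]
  obtain ⟨i, hi⟩ := exists_star_mul_self_apply_ne_zero hj
  refine ⟨_, starPos_star_mul_self_apply (N j) i, hi, MatCuntzLE.trans ?_ (hm j)⟩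
  generalize star (N j) * N j = X
  convert matCuntzLE_submatrix (flat (Matrix.blockDiagonal fun _ : Fin m => X))
    fun b : Fin k × Fin m => ((i, b.2), b.1) using 1
  ext ⟨l, c⟩ ⟨l', c'⟩
  by_cases hc : c = c' <;> simp [Matrix.blockDiagonal_apply, hc]

theorem matCuntzLE_fromBlocks_of_norm_lt {r h e : Matrix (Fin k) (Fin k) A} {ε : ℝ}
    (h0 : 0 ≤ toCStarMatrix A k h) (h1 : 0 ≤ toCStarMatrix A k (1 - h))
    (he : 0 ≤ toCStarMatrix A k e)
    (hlt : ‖toCStarMatrix A k (e - star r * (h * h) * r)‖ < ε) :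
    MatCuntzLE Set.univ
      ((toCStarMatrix A k).symm (cutoff ε (toCStarMatrix A k (star r * r))))
      (Matrix.fromBlocks e 0 0 (1 - h)) := by
  obtain ⟨w, hw, hwh⟩ := exists_conj_one_sub h0
  obtain ⟨w, rfl⟩ := (toCStarMatrix A k).surjective w
  have hws : star w = w := (toCStarMatrix A k).injective hw
  have hwh' : w * (1 - h) * w = 1 - h * h := by
    apply (toCStarMatrix A k).injective
    rw [map_mul, map_mul, map_sub, map_sub, map_one, map_mul]
    exact hwh
  set y := star r * w with hy
  have hyy : y * (1 - h) * star y = star r * r - star r * (h * h) * r := by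
    calc y * (1 - h) * star y = star r * (w * (1 - h) * w) * r := by
          rw [hy, star_mul, star_star, hws]; simp only [mul_assoc]
      _ = star r * r - star r * (h * h) * r := by rw [hwh']; noncomm_ring
  have hz : 0 ≤ toCStarMatrix A k (e + y * (1 - h) * star y) := by
    rw [map_add, map_mul, map_mul, toCStarMatrix_star]
    exact add_nonneg he (star_right_conjugate_nonneg h1 _)
  have hcut := cuntzG_of_mem_closure (cutoff_mem_closure_conj (ε := ε)
    (StarPos.nonneg ⟨r, rfl⟩).isSelfAdjoint hz (by
      have hsub : star r * r - (e + y * (1 - h) * star y) = -(e - star r * (h * h) * r) := by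
        rw [hyy]; abel
      rw [← map_sub, hsub, map_neg, norm_neg]
      exact hlt))
  rw [AlgEquiv.symm_apply_apply] at hcut
  refine hcut.trans ?_
  convert matCuntzLE_conj (Matrix.fromCols 1 y) (Matrix.fromBlocks e 0 0 (1 - h)) using 1
  simp [Matrix.fromCols_mul_fromBlocks, Matrix.conjTranspose_fromCols_eq_fromRows_conjTranspose,
    Matrix.fromCols_mul_fromRows, Matrix.star_eq_conjTranspose]

end Divisibility

section Enlarge

variable {A : Type*} [NormedRing A] [StarRing A] {K k m n : ℕ}

/-- The block sum of a matrix of matrices and a matrix, indexed by an initial segment of `ℕ`. -/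
noncomputable def enlarge (X : Matrix (Fin K) (Fin K) (Matrix (Fin k) (Fin k) A))
    (s : Matrix (Fin k) (Fin k) A) :
    Matrix (Fin (Fintype.card ((Fin K × Fin k) ⊕ Fin k)))
      (Fin (Fintype.card ((Fin K × Fin k) ⊕ Fin k))) A :=
  (Matrix.fromBlocks (flat X) 0 0 s).submatrix (Fintype.equivFin _).symm (Fintype.equivFin _).symm

theorem enlarge_star_mul_self (N : Matrix (Fin K) (Fin K) (Matrix (Fin k) (Fin k) A))
    (y : Matrix (Fin k) (Fin k) A) :
    enlarge (star N * N) (star y * y) = star (enlarge N y) * enlarge N y := by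
  simp only [enlarge, Matrix.star_eq_conjTranspose]
  rw [Matrix.conjTranspose_submatrix, Matrix.submatrix_mul_equiv,
    Matrix.fromBlocks_conjTranspose, Matrix.fromBlocks_multiply, ← flat_conjTranspose,
    ← flat_mul Nᴴ N (Nᴴ * N) fun _ _ => rfl]
  simp

theorem matCuntzLE_blockDiagonal_enlarge
    (X : Fin n → Matrix (Fin K) (Fin K) (Matrix (Fin k) (Fin k) A))
    (s : Matrix (Fin k) (Fin k) A) (j : Fin n) :
    MatCuntzLE Set.univ (Matrix.fromBlocks (flat (Matrix.blockDiagonal X)) 0 0 s)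
      (Matrix.blockDiagonal fun i => enlarge (X i) s) := by
  convert matCuntzLE_submatrix (Matrix.blockDiagonal fun i => enlarge (X i) s)
    (Sum.elim (fun b : (Fin K × Fin n) × Fin k => (Fintype.equivFin _ (Sum.inl (b.1.1, b.2)), b.1.2))
      fun b => (Fintype.equivFin _ (Sum.inr b), j)) using 1
  ext (⟨⟨i, c⟩, l⟩ | l) (⟨⟨i', c'⟩, l'⟩ | l')
  · by_cases hc : c = c' <;> simp [Matrix.blockDiagonal_apply, enlarge, hc]
  · by_cases hc : c = j <;> simp [Matrix.blockDiagonal_apply, enlarge, hc]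
  · by_cases hc : j = c' <;> simp [Matrix.blockDiagonal_apply, enlarge, hc]
  · simp [enlarge]

theorem blockDiagonal_enlarge_matCuntzLE
    (X : Matrix (Fin K) (Fin K) (Matrix (Fin k) (Fin k) A)) (s : Matrix (Fin k) (Fin k) A) :
    MatCuntzLE Set.univ (Matrix.blockDiagonal fun _ : Fin m => enlarge X s)
      (Matrix.fromBlocks (flat (Matrix.blockDiagonal fun _ : Fin m => X)) 0 0
        (Matrix.blockDiagonal fun _ : Fin m => s)) := by
  convert matCuntzLE_submatrix (Matrix.fromBlocks (flat (Matrix.blockDiagonal fun _ : Fin m => X))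
    0 0 (Matrix.blockDiagonal fun _ : Fin m => s))
    (fun b : Fin (Fintype.card ((Fin K × Fin k) ⊕ Fin k)) × Fin m =>
      Sum.map (fun a : Fin K × Fin k => ((a.1, b.2), a.2)) (fun a : Fin k => (a, b.2))
        ((Fintype.equivFin _).symm b.1)) using 1
  ext ⟨l, c⟩ ⟨l', c'⟩
  obtain ⟨l, rfl⟩ := (Fintype.equivFin _).surjective l
  obtain ⟨l', rfl⟩ := (Fintype.equivFin _).surjective l'
  rcases l with ⟨i, l⟩ | l <;> rcases l' with ⟨i', l'⟩ | l' <;> by_cases hc : c = c' <;>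
    simp [Matrix.blockDiagonal_apply, enlarge, hc]

theorem fromBlocks_matCuntzLE_blockDiagonal (a : Matrix (Fin k) (Fin k) A) :
    MatCuntzLE Set.univ (Matrix.fromBlocks a 0 0 a) (Matrix.blockDiagonal fun _ : Fin 2 => a) := by
  convert matCuntzLE_submatrix (Matrix.blockDiagonal fun _ : Fin 2 => a)
    (Sum.elim (fun b => (b, 0)) fun b => (b, 1)) using 1
  ext (l | l) (l' | l') <;> simp [Matrix.blockDiagonal_apply]

end Enlarge

theorem cutoff_zero {D : Type*} [CStarAlgebra D] {ε : ℝ} (hε : 0 ≤ ε) : cutoff ε (0 : D) = 0 := by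
  rw [cutoff, cfc_apply_zero]
  simp [hε]

theorem matCuntzLE_zero {A : Type*} [NormedRing A] [StarRing A] {I J : Type} [Fintype I]
    [Fintype J] (y : Matrix J J A) : MatCuntzLE Set.univ (0 : Matrix I I A) y := by
  simpa using matCuntzLE_conj (0 : Matrix I J A) y

theorem IsCutoff.eq_symm_cutoff {A : Type*} [CStarAlgebra A] [PartialOrder A] [StarOrderedRing A]
    {k : ℕ} {ε M : ℝ} {a b : Matrix (Fin k) (Fin k) A} (h : IsCutoff ε M a b) (ha : StarPos a) :
    b = (toCStarMatrix A k).symm (cutoff ε (toCStarMatrix A k a)) := by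
  have hφ : ∀ (z : ℕ → Matrix (Fin k) (Fin k) A) (w : Matrix (Fin k) (Fin k) A),
      Tendsto (fun j => ‖z j - w‖) atTop (nhds 0) →
        Tendsto (fun j => toCStarMatrix A k (z j)) atTop (nhds (toCStarMatrix A k w)) :=
    fun z w => (tendsto_toCStarMatrix_iff z w).2
  have hb : toCStarMatrix A k b = cutoff ε (toCStarMatrix A k a) :=
    h.map_eq_cutoff (φ := toCStarMatrix A k) hφ ha.nonneg.isSelfAdjoint
  rw [← hb, AlgEquiv.symm_apply_apply]

/-- **Theorem 3.7.** Let `Ω` be a class of unital C*-algebras each weakly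
`(m, n)`-divisible, `m ≠ n`.  If `A` is a simple unital stably finite C*-algebra with
`A ∈ WTAΩ` and `M_k(A) ∈ WTAΩ` for every `k`, then `A` is secondly weakly
`(m, n)`-divisible. -/
theorem secondly_weakly_divisible_of_wta {A : Type*} [CStarAlgebra A] [PartialOrder A]
    [StarOrderedRing A]
    (m n : ℕ) (hm : 1 ≤ m) (hn : 1 ≤ n) (hmn : m ≠ n)
    (hsimple : IsSimpleCStar A) (hSF : StablyFinite A)
    (Ω₀ : Set (NonUnitalStarSubalgebra ℂ A × A))
    (Ω : ∀ k : ℕ, Set (NonUnitalStarSubalgebra ℂ (Matrix (Fin k) (Fin k) A)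
      × Matrix (Fin k) (Fin k) A))
    (hΩ₀div : ∀ Bp ∈ Ω₀, WeaklyDivOn (Bp.1 : Set A) m n)
    (hΩdiv : ∀ k : ℕ, ∀ Bp ∈ Ω k,
      WeaklyDivOn (Bp.1 : Set (Matrix (Fin k) (Fin k) A)) m n)
    (hA : WTAMemG Ω₀)
    (hMk : ∀ k : ℕ, WTAMemG (Ω k)) :
    SecondlyWeaklyDivOn (Set.univ : Set A) m n := by
  rintro k _ - ⟨r, -, rfl⟩ ε hε
  by_cases hr : star r * r = 0
  · refine ⟨0, 0, fun _ _ _ => trivial, fun j => ⟨0, fun _ _ => trivial, by simp⟩, fun j => ?_,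
      fun M b hb => ?_⟩
    · rw [Subsingleton.elim (Matrix.blockDiagonal _) 0]
      exact matCuntzLE_zero _
    · rw [hb.eq_symm_cutoff ⟨r, rfl⟩, hr, map_zero, cutoff_zero hε.le, map_zero]
      exact matCuntzLE_zero _
  obtain ⟨s, ⟨y, rfl⟩, hs0, hsm⟩ := exists_blockDiagonal_matCuntzLE (hΩdiv k) (hMk k) hr
  obtain ⟨h, e, K, N, h0, h1, he, hcompress, hcomm, -, hxm, hxn, hsub⟩ :=
    exists_divisible_approximation (hΩdiv k) (hMk k) r ⟨y, rfl⟩ hs0 (δ := ε / 4) (by positivity)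
  have hclose : ‖toCStarMatrix A k (e - star r * (h * h) * r)‖ < ε := by
    rw [← sub_add_sub_cancel e (h * (star r * r) * h), map_add]
    exact (norm_add_le _ _).trans_lt (by linarith)
  refine ⟨_, fun j => enlarge (star (N j) * N j) (star y * y), fun _ _ _ => trivial,
    fun j => ⟨enlarge (N j) y, fun _ _ => trivial, enlarge_star_mul_self _ _⟩, fun j => ?_,
    fun M b hb => ?_⟩
  · exact (blockDiagonal_enlarge_matCuntzLE _ _).trans
      (((hxm j).fromBlocks hsm).trans (fromBlocks_matCuntzLE_blockDiagonal _))
  · rw [hb.eq_symm_cutoff ⟨r, rfl⟩]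
    exact (matCuntzLE_fromBlocks_of_norm_lt h0 h1 he hclose).trans
      ((hxn.fromBlocks hsub).trans (matCuntzLE_blockDiagonal_enlarge _ _ ⟨0, hn⟩))
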